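/- For all integers 1 ≤ r ≤ s and every bounded measurable function h : X → ℝ with φ_{s|s}(h) = 0, V_{χ,r,s}[h] ≤ ‖ϑ_r‖_∞·‖ω_r‖_∞·(σ₊/(c₋·σ₋))·ρ^{2(s−r)}·osc(h)². -/

import Mathlib

open MeasureTheory

noncomputable section

variable {X : Type*} [MeasurableSpace X]

/-- `ell ν q g s n x y` is the kernel density `ℓ_{s, s+n+1}(x, y)`:
`ℓ_{s,s+1}(x,y) = q(x,y) g_{s+1}(y)` and
`ℓ_{s,t+1}(x,y) = ∫ ℓ_{s,t}(x,z) q(z,y) g_{t+1}(y) ν(dz)`. -/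
def ell (ν : Measure X) (q : X → X → ℝ) (g : ℕ → X → ℝ) (s : ℕ) : ℕ → X → X → ℝ
  | 0 => fun x y => q x y * g (s + 1) y
  | n + 1 => fun x y => ∫ z, ell ν q g s n x z * (q z y * g (s + n + 2) y) ∂ν

/-- `ℓ_{s,t}` for `s < t`. -/
def ellST (ν : Measure X) (q : X → X → ℝ) (g : ℕ → X → ℝ) (s t : ℕ) : X → X → ℝ :=
  ell ν q g s (t - s - 1)

/-- `L_{s,t}(x,h) = ∫ ℓ_{s,t}(x,y) h(y) ν(dy)`, with the convention `L_{t,t}(x,h) = h x`. -/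
def Lop (ν : Measure X) (q : X → X → ℝ) (g : ℕ → X → ℝ) (s t : ℕ) (x : X) (h : X → ℝ) : ℝ :=
  if s < t then ∫ y, ellST ν q g s t x y * h y ∂ν else h x

/-- filtering distribution `φ_{t|t}(h)` (for `t = 0` this is `χ(g₀h)/χ(g₀)`). -/
def philt (ν χ : Measure X) (q : X → X → ℝ) (g : ℕ → X → ℝ) (t : ℕ) (h : X → ℝ) : ℝ :=
  (∫ x, g 0 x * Lop ν q g 0 t x h ∂χ) / ∫ x, g 0 x * Lop ν q g 0 t x (fun _ => 1) ∂χ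

/-- one-step predictor `φ_{t|t-1}(h) = φ_{t-1|t-1}(x ↦ ∫ q(x,y)h(y)ν(dy))`. -/
def phipred (ν χ : Measure X) (q : X → X → ℝ) (g : ℕ → X → ℝ) (t : ℕ) (h : X → ℝ) : ℝ :=
  philt ν χ q g (t - 1) (fun x => ∫ y, q x y * h y ∂ν)

/-- importance weight `ω_t(x,x') = q(x,x') g_t(x') / (ϑ_t(x) p_t(x,x'))`. -/
def omegaFn (q : X → X → ℝ) (g : ℕ → X → ℝ) (ϑ : ℕ → X → ℝ) (p : ℕ → X → X → ℝ)
    (t : ℕ) (x y : X) : ℝ :=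
  q x y * g t y / (ϑ t x * p t x y)

/-- oscillation of a function -/
def osc {Y : Type*} (h : Y → ℝ) : ℝ := ⨆ pr : Y × Y, |h pr.1 - h pr.2|

/-- `V_{χ,r,s}[h]` for `1 ≤ r ≤ s`. -/
def Vr (ν χ : Measure X) (q : X → X → ℝ) (g : ℕ → X → ℝ)
    (ϑ : ℕ → X → ℝ) (p : ℕ → X → X → ℝ) (r s : ℕ) (h : X → ℝ) : ℝ :=
  philt ν χ q g (r - 1)
      (fun x => ϑ r x * ∫ y, p r x y * omegaFn q g ϑ p r x y ^ 2 * Lop ν q g r s y h ^ 2 ∂ν) *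
    philt ν χ q g (r - 1) (ϑ r) /
      phipred ν χ q g r (fun x => g r x * Lop ν q g r s x fun _ => 1) ^ 2

end

namespace FeynmanKac

/-- Bounded measurable real functions. -/
def BddMeas {Y : Type*} [MeasurableSpace Y] (f : Y → ℝ) : Prop :=
  Measurable f ∧ ∃ K, ∀ y, |f y| ≤ K

namespace BddMeas

variable {Y Z : Type*} [MeasurableSpace Y] [MeasurableSpace Z]

lemma const (c : ℝ) : BddMeas (fun _ : Y => c) := ⟨measurable_const, |c|, fun _ => le_rfl⟩

lemma mul {f f' : Y → ℝ} (hf : BddMeas f) (hf' : BddMeas f') :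
    BddMeas (fun y => f y * f' y) := by
  obtain ⟨hm, K, hK⟩ := hf
  obtain ⟨hm', K', hK'⟩ := hf'
  refine ⟨hm.mul hm', K * K', fun y => ?_⟩
  rw [abs_mul]
  exact mul_le_mul (hK y) (hK' y) (abs_nonneg _) ((abs_nonneg _).trans (hK y))

lemma comp {f : Y → ℝ} (hf : BddMeas f) {φ : Z → Y} (hφ : Measurable φ) :
    BddMeas (fun z => f (φ z)) :=
  ⟨hf.1.comp hφ, hf.2.imp fun _ hK z => hK (φ z)⟩

lemma integrable {f : Y → ℝ} (hf : BddMeas f) (μ : Measure Y) [IsFiniteMeasure μ] :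
    Integrable f μ := by
  obtain ⟨hm, K, hK⟩ := hf
  exact Integrable.of_mem_Icc (-K) K hm.aemeasurable (.of_forall fun y => abs_le.1 (hK y))

lemma integral {F : Z × Y → ℝ} (hF : BddMeas F) (μ : Measure Y) [IsFiniteMeasure μ] :
    BddMeas (fun z => ∫ y, F (z, y) ∂μ) := by
  obtain ⟨hm, K, hK⟩ := hF
  refine ⟨hm.stronglyMeasurable.integral_prod_right'.measurable, K * μ.real Set.univ,
    fun z => ?_⟩
  exact norm_integral_le_of_norm_le_const (f := fun y => F (z, y)) (.of_forall fun y => hK (z, y))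

end BddMeas

variable {X : Type*} [MeasurableSpace X]

/-- The unnormalised transition operator `f ↦ ∫ q(x, y) w(y) f(y) ν(dy)`. -/
noncomputable def transOp (ν : Measure X) (q : X → X → ℝ) (w f : X → ℝ) (x : X) : ℝ :=
  ∫ y, q x y * (w y * f y) ∂ν

/-- The composition of the operators `transOp` with weights `g (s + 1), …, g (s + n)`. -/
noncomputable def propagate (ν : Measure X) (q : X → X → ℝ) (g : ℕ → X → ℝ) :
    ℕ → ℕ → (X → ℝ) → X → ℝ
  | _, 0, f => f
  | s, n + 1, f => transOp ν q (g (s + 1)) (propagate ν q g (s + 1) n f)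

lemma propagate_add (ν : Measure X) (q : X → X → ℝ) (g : ℕ → X → ℝ) (s m n : ℕ) (f : X → ℝ) :
    propagate ν q g s (m + n) f = propagate ν q g s m (propagate ν q g (s + m) n f) := by
  induction m generalizing s with
  | zero => simp [propagate]
  | succ m ih =>
    rw [show m + 1 + n = (m + n) + 1 by ring, propagate, propagate, ih,
      show s + 1 + m = s + (m + 1) by ring]

lemma transOp_const_mul {ν : Measure X} {q : X → X → ℝ} {w f : X → ℝ} (c : ℝ) (x : X) :
    transOp ν q w (fun y => c * f y) x = c * transOp ν q w f x := by
  rw [transOp, transOp, ← integral_const_mul]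
  congr 1; ext y; ring

lemma propagate_const_mul {ν : Measure X} {q : X → X → ℝ} {g : ℕ → X → ℝ} {f : X → ℝ}
    (c : ℝ) (s n : ℕ) :
    propagate ν q g s n (fun y => c * f y) = fun x => c * propagate ν q g s n f x := by
  induction n generalizing s with
  | zero => rfl
  | succ n ih => ext x; simp only [propagate, ih, transOp_const_mul]

section Operators

variable {ν : Measure X} [IsFiniteMeasure ν] {q : X → X → ℝ} {g : ℕ → X → ℝ} {w f f' : X → ℝ}

lemma bddMeas_section (hq : BddMeas fun pr : X × X => q pr.1 pr.2) (x : X) : BddMeas (q x) :=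
  hq.comp measurable_prodMk_left

lemma bddMeas_transOp (hq : BddMeas fun pr : X × X => q pr.1 pr.2) (hw : BddMeas w)
    (hf : BddMeas f) : BddMeas (transOp ν q w f) :=
  (hq.mul ((hw.mul hf).comp measurable_snd)).integral ν

lemma transOp_mono (hq : BddMeas fun pr : X × X => q pr.1 pr.2) (hq0 : ∀ x y, 0 ≤ q x y)
    (hw : BddMeas w) (hw0 : ∀ x, 0 ≤ w x) (hf : BddMeas f) (hf' : BddMeas f')
    (hle : ∀ x, f x ≤ f' x) (x : X) : transOp ν q w f x ≤ transOp ν q w f' x :=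
  integral_mono (((bddMeas_section hq x).mul (hw.mul hf)).integrable ν)
    (((bddMeas_section hq x).mul (hw.mul hf')).integrable ν)
    fun y => mul_le_mul_of_nonneg_left (mul_le_mul_of_nonneg_left (hle y) (hw0 y)) (hq0 x y)

lemma bddMeas_propagate (hq : BddMeas fun pr : X × X => q pr.1 pr.2) (hg : ∀ t, BddMeas (g t))
    (hf : BddMeas f) (s n : ℕ) : BddMeas (propagate ν q g s n f) := by
  induction n generalizing s with
  | zero => exact hf
  | succ n ih => exact bddMeas_transOp hq (hg _) (ih _)

lemma propagate_mono (hq : BddMeas fun pr : X × X => q pr.1 pr.2) (hq0 : ∀ x y, 0 ≤ q x y)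
    (hg : ∀ t, BddMeas (g t)) (hg0 : ∀ t x, 0 ≤ g t x) (hf : BddMeas f) (hf' : BddMeas f')
    (hle : ∀ x, f x ≤ f' x) (s n : ℕ) (x : X) :
    propagate ν q g s n f x ≤ propagate ν q g s n f' x := by
  induction n generalizing s x with
  | zero => exact hle x
  | succ n ih =>
    exact transOp_mono hq hq0 (hg _) (hg0 _) (bddMeas_propagate hq hg hf _ _)
      (bddMeas_propagate hq hg hf' _ _) (ih _) x

lemma bddMeas_ell (hq : BddMeas fun pr : X × X => q pr.1 pr.2) (hg : ∀ t, BddMeas (g t))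
    (s n : ℕ) : BddMeas (fun pr : X × X => ell ν q g s n pr.1 pr.2) := by
  induction n with
  | zero => exact hq.mul ((hg _).comp measurable_snd)
  | succ n ih =>
    have hl : Measurable fun z : (X × X) × X => (z.1.1, z.2) := by fun_prop
    have hr : Measurable fun z : (X × X) × X => (z.2, z.1.2) := by fun_prop
    have hy : Measurable fun z : (X × X) × X => z.1.2 := by fun_prop
    exact ((ih.comp hl).mul ((hq.comp hr).mul ((hg (s + n + 2)).comp hy))).integral ν

lemma integral_ell_mul (hq : BddMeas fun pr : X × X => q pr.1 pr.2) (hg : ∀ t, BddMeas (g t))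
    (hf : BddMeas f) (s n : ℕ) (x : X) :
    ∫ y, ell ν q g s n x y * f y ∂ν = propagate ν q g s (n + 1) f x := by
  induction n generalizing f with
  | zero => simp only [ell, propagate, transOp, mul_assoc]
  | succ n ih =>
    rw [propagate_add ν q g s (n + 1) 1 f]
    change _ = propagate ν q g s (n + 1) (transOp ν q (g (s + (n + 1) + 1)) f) x
    rw [← ih (bddMeas_transOp hq (hg _) hf)]
    have hint : Integrable (Function.uncurry fun y z =>
        ell ν q g s n x z * (q z y * g (s + n + 2) y) * f y) (ν.prod ν) := by
      refine BddMeas.integrable ?_ _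
      have hr : Measurable fun z : X × X => (z.2, z.1) := by fun_prop
      exact ((((bddMeas_section (bddMeas_ell hq hg s n) x).comp measurable_snd).mul
        ((hq.comp hr).mul ((hg (s + n + 2)).comp measurable_fst))).mul (hf.comp measurable_fst))
    simp only [ell, ← integral_mul_const]
    rw [integral_integral_swap hint]
    congr 1; ext z
    rw [transOp, ← integral_const_mul]
    congr 1; ext y
    rw [show s + (n + 1) + 1 = s + n + 2 by ring]
    ring

lemma Lop_eq_propagate (hq : BddMeas fun pr : X × X => q pr.1 pr.2) (hg : ∀ t, BddMeas (g t))
    (hf : BddMeas f) (s n : ℕ) (x : X) :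
    Lop ν q g s (s + n) x f = propagate ν q g s n f x := by
  cases n with
  | zero => simp [Lop, propagate]
  | succ n =>
    rw [Lop, if_pos (by omega), ellST, show s + (n + 1) - s - 1 = n by omega,
      integral_ell_mul hq hg hf]

end Operators

section Mixing

variable {ν : Measure X} [IsFiniteMeasure ν] {q : X → X → ℝ} {g : ℕ → X → ℝ} {σm σp cm : ℝ}

/-- The integrals `∫ q(x, ·) w dν` are comparable to `∫ w dν`, uniformly in `x`. -/
lemma integral_kernel_mul_bounds (hqm : BddMeas fun pr : X × X => q pr.1 pr.2)
    (hq : ∀ x y, σm ≤ q x y ∧ q x y ≤ σp) {w : X → ℝ} (hw : BddMeas w) (hw0 : ∀ x, 0 ≤ w x)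
    (x : X) : σm * ∫ y, w y ∂ν ≤ ∫ y, q x y * w y ∂ν ∧
      ∫ y, q x y * w y ∂ν ≤ σp * ∫ y, w y ∂ν := by
  have hi := ((bddMeas_section hqm x).mul hw).integrable ν
  rw [← integral_const_mul, ← integral_const_mul]
  exact ⟨integral_mono ((hw.integrable ν).const_mul _) hi
      fun y => mul_le_mul_of_nonneg_right (hq x y).1 (hw0 y),
    integral_mono hi ((hw.integrable ν).const_mul _)
      fun y => mul_le_mul_of_nonneg_right (hq x y).2 (hw0 y)⟩

lemma propagate_one_bounds (hσm : 0 < σm) (hσmp : σm ≤ σp) (hcm : 0 < cm)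
    (hqm : BddMeas fun pr : X × X => q pr.1 pr.2)
    (hq : ∀ x y, σm ≤ q x y ∧ q x y ≤ σp) (hg : ∀ t, BddMeas (g t)) (hg0 : ∀ t x, 0 ≤ g t x)
    (hqg : ∀ t, 1 ≤ t → ∀ x, cm ≤ ∫ y, q x y * g t y ∂ν) [Nonempty X] (s n : ℕ) :
    ∃ b B : ℝ, 0 < b ∧ B * σm ≤ σp * b ∧
      ∀ x, b ≤ propagate ν q g s n (fun _ => 1) x ∧ propagate ν q g s n (fun _ => 1) x ≤ B := by
  induction n generalizing s with
  | zero => exact ⟨1, 1, one_pos, by linarith, fun x => ⟨le_rfl, le_rfl⟩⟩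
  | succ n ih =>
    obtain ⟨b, B, hb, -, hbB⟩ := ih (s + 1)
    have hL := bddMeas_propagate (ν := ν) hqm hg (.const 1) (s + 1) n
    set L := propagate ν q g (s + 1) n (fun _ => 1)
    have hbounds := integral_kernel_mul_bounds (ν := ν) hqm hq ((hg (s + 1)).mul hL)
      fun x => mul_nonneg (hg0 _ x) (hb.le.trans (hbB x).1)
    set A := ∫ y, g (s + 1) y * L y ∂ν
    have hA : 0 < A := by
      obtain ⟨x⟩ := ‹Nonempty X›
      have hlow : b * cm ≤ ∫ y, q x y * (g (s + 1) y * L y) ∂ν := by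
        have hmono := transOp_mono (ν := ν) hqm (fun x y => hσm.le.trans (hq x y).1)
          (hg (s + 1)) (hg0 _) ((BddMeas.const b).mul (.const 1)) hL
          (fun y => by simpa using (hbB y).1) x
        rw [transOp_const_mul] at hmono
        simp only [transOp, mul_one] at hmono
        exact (mul_le_mul_of_nonneg_left (hqg (s + 1) (by omega) x) hb.le).trans hmono
      have := (hlow.trans (hbounds x).2)
      have h1 : 0 < σp * A := (mul_pos hb hcm).trans_le this
      exact (pos_iff_pos_of_mul_pos h1).1 (hσm.trans_le hσmp)
    exact ⟨σm * A, σp * A, mul_pos hσm hA, by linarith, hbounds⟩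

/-- One-step Doeblin contraction: the ratio `∫ q(x, ·) u dν / ∫ q(x, ·) w dν` takes values in an
interval shrunk by the factor `1 - σm / σp`. -/
lemma exists_contracted_interval (hσm : 0 < σm) (hσmp : σm ≤ σp)
    (hqm : BddMeas fun pr : X × X => q pr.1 pr.2)
    (hq : ∀ x y, σm ≤ q x y ∧ q x y ≤ σp) {u w : X → ℝ} (hu : BddMeas u) (hw : BddMeas w)
    (hw0 : ∀ x, 0 ≤ w x) (hA : 0 < ∫ y, w y ∂ν) {a b : ℝ}
    (hab : ∀ x, a * w x ≤ u x ∧ u x ≤ b * w x) :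
    ∃ a' b', b' - a' = (1 - σm / σp) * (b - a) ∧
      ∀ x, a' * ∫ y, q x y * w y ∂ν ≤ ∫ y, q x y * u y ∂ν ∧
        ∫ y, q x y * u y ∂ν ≤ b' * ∫ y, q x y * w y ∂ν := by
  have hσp := hσm.trans_le hσmp
  have hbounds := integral_kernel_mul_bounds (ν := ν) hqm hq hw hw0
  set A := ∫ y, w y ∂ν
  set U := ∫ y, u y ∂ν
  set ε := σm / σp with hε
  refine ⟨ε * (U / A) + (1 - ε) * a, ε * (U / A) + (1 - ε) * b, by ring, fun x => ?_⟩
  set D := ∫ y, q x y * w y ∂ν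
  set κ := ε * D / A
  have hκ : ∀ y, κ ≤ q x y := fun y => by
    refine le_trans ?_ (hq x y).1
    rw [div_le_iff₀ hA, hε, div_mul_eq_mul_div, div_le_iff₀ hσp]
    nlinarith [(hbounds x).2]
  have hsplit : ∀ v : X → ℝ, BddMeas v →
      Integrable (fun y => (q x y - κ) * v y) ν ∧
      ∫ y, (q x y - κ) * v y ∂ν = ∫ y, q x y * v y ∂ν - κ * ∫ y, v y ∂ν := fun v hv => by
    have hqv := ((bddMeas_section hqm x).mul hv).integrable ν
    have hκv := (hv.integrable ν).const_mul κ
    simp only [sub_mul]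
    exact ⟨hqv.sub hκv, by rw [integral_sub hqv hκv, integral_const_mul]⟩
  obtain ⟨hiu, heu⟩ := hsplit u hu
  obtain ⟨hiw, hew⟩ := hsplit w hw
  have hlow : a * ∫ y, (q x y - κ) * w y ∂ν ≤ ∫ y, (q x y - κ) * u y ∂ν := by
    rw [← integral_const_mul]
    exact integral_mono (hiw.const_mul a) hiu fun y => by
      nlinarith [mul_le_mul_of_nonneg_left (hab y).1 (sub_nonneg.2 (hκ y))]
  have hupp : ∫ y, (q x y - κ) * u y ∂ν ≤ b * ∫ y, (q x y - κ) * w y ∂ν := by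
    rw [← integral_const_mul]
    exact integral_mono hiu (hiw.const_mul b) fun y => by
      nlinarith [mul_le_mul_of_nonneg_left (hab y).2 (sub_nonneg.2 (hκ y))]
  rw [heu, hew] at hlow hupp
  have hκA : κ * A = ε * D := div_mul_cancel₀ _ hA.ne'
  have hκU : κ * U = ε * (U / A) * D := by simp only [κ]; ring
  change a * (D - κ * A) ≤ _ - κ * U at hlow
  change _ - κ * U ≤ b * (D - κ * A) at hupp
  rw [hκA, hκU] at hlow hupp
  constructor <;> linarith

/-- Geometric forgetting for the normalised operators. -/
lemma exists_propagate_interval (hσm : 0 < σm) (hσmp : σm ≤ σp) (hcm : 0 < cm)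
    (hqm : BddMeas fun pr : X × X => q pr.1 pr.2)
    (hq : ∀ x y, σm ≤ q x y ∧ q x y ≤ σp) (hg : ∀ t, BddMeas (g t)) (hg0 : ∀ t x, 0 ≤ g t x)
    (hqg : ∀ t, 1 ≤ t → ∀ x, cm ≤ ∫ y, q x y * g t y ∂ν) [Nonempty X] {f : X → ℝ}
    (hf : BddMeas f) {a b : ℝ} (hab : ∀ x, a ≤ f x ∧ f x ≤ b) (s n : ℕ) :
    ∃ a' b', b' - a' = (1 - σm / σp) ^ n * (b - a) ∧
      ∀ x, a' * propagate ν q g s n (fun _ => 1) x ≤ propagate ν q g s n f x ∧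
        propagate ν q g s n f x ≤ b' * propagate ν q g s n (fun _ => 1) x := by
  induction n generalizing s with
  | zero => exact ⟨a, b, by ring, by simpa [propagate] using hab⟩
  | succ n ih =>
    obtain ⟨a₁, b₁, hd, hle⟩ := ih (s + 1)
    obtain ⟨β, _, hβ, -, hβL⟩ := propagate_one_bounds (ν := ν) hσm hσmp hcm hqm hq hg hg0 hqg
      (s + 1) n
    obtain ⟨β', _, hβ', -, hβL'⟩ := propagate_one_bounds (ν := ν) hσm hσmp hcm hqm hq hg hg0 hqg
      s (n + 1)
    have hL := (hg (s + 1)).mul (bddMeas_propagate (ν := ν) hqm hg (.const 1) (s + 1) n)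
    have hF := (hg (s + 1)).mul (bddMeas_propagate (ν := ν) hqm hg hf (s + 1) n)
    have hL0 : ∀ x, 0 ≤ g (s + 1) x * propagate ν q g (s + 1) n (fun _ => 1) x :=
      fun x => mul_nonneg (hg0 _ x) (hβ.le.trans (hβL x).1)
    have hA : 0 < ∫ y, g (s + 1) y * propagate ν q g (s + 1) n (fun _ => 1) y ∂ν := by
      obtain ⟨x⟩ := ‹Nonempty X›
      exact (pos_iff_pos_of_mul_pos ((hβ'.trans_le (hβL' x).1).trans_le
        (integral_kernel_mul_bounds hqm hq hL hL0 x).2)).1 (hσm.trans_le hσmp)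
    obtain ⟨a', b', hd', hle'⟩ := exists_contracted_interval hσm hσmp hqm hq hF hL hL0 hA
      (a := a₁) (b := b₁) fun x => by
        constructor
        · nlinarith [mul_le_mul_of_nonneg_left (hle x).1 (hg0 (s + 1) x)]
        · nlinarith [mul_le_mul_of_nonneg_left (hle x).2 (hg0 (s + 1) x)]
    exact ⟨a', b', by rw [hd', hd]; ring, hle'⟩

end Mixing

lemma exists_bounds_sub_le_osc {Y : Type*} [Nonempty Y] {f : Y → ℝ} (hf : ∃ K, ∀ y, |f y| ≤ K) :
    ∃ a b, a ≤ b ∧ b - a ≤ osc f ∧ ∀ y, a ≤ f y ∧ f y ≤ b := by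
  obtain ⟨K, hK⟩ := hf
  have hbelow : BddBelow (Set.range f) := ⟨-K, by rintro _ ⟨y, rfl⟩; exact (abs_le.1 (hK y)).1⟩
  have habove : BddAbove (Set.range f) := ⟨K, by rintro _ ⟨y, rfl⟩; exact (abs_le.1 (hK y)).2⟩
  have hosc : ∀ y z, f y - f z ≤ osc f := fun y z => by
    refine (le_abs_self _).trans (le_ciSup (f := fun pr : Y × Y => |f pr.1 - f pr.2|) ?_ (y, z))
    refine ⟨K + K, ?_⟩
    rintro _ ⟨pr, rfl⟩
    exact (abs_sub _ _).trans (add_le_add (hK _) (hK _))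
  refine ⟨⨅ y, f y, ⨆ y, f y, ?_, ?_, fun y => ⟨ciInf_le hbelow y, le_ciSup habove y⟩⟩
  · obtain ⟨y⟩ := ‹Nonempty Y›
    exact (ciInf_le hbelow y).trans (le_ciSup habove y)
  · have : ⨆ y, f y ≤ osc f + ⨅ z, f z := ciSup_le fun y => by
      have : f y - osc f ≤ ⨅ z, f z := le_ciInf fun z => by linarith [hosc y z]
      linarith
    linarith

/-- The unnormalised filter at time `n`, so that `φ_{n|n}(f)` is `unnormFilter n f` divided by
`unnormFilter n 1`. -/
noncomputable def unnormFilter (ν χ : Measure X) (q : X → X → ℝ) (g : ℕ → X → ℝ) (n : ℕ)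
    (f : X → ℝ) : ℝ :=
  ∫ x, g 0 x * propagate ν q g 0 n f x ∂χ

lemma unnormFilter_mono {ν χ : Measure X} [IsFiniteMeasure ν] [IsFiniteMeasure χ]
    {q : X → X → ℝ} {g : ℕ → X → ℝ} {f f' : X → ℝ}
    (hq : BddMeas fun pr : X × X => q pr.1 pr.2) (hq0 : ∀ x y, 0 ≤ q x y)
    (hg : ∀ t, BddMeas (g t)) (hg0 : ∀ t x, 0 ≤ g t x) (hf : BddMeas f) (hf' : BddMeas f')
    (hle : ∀ x, f x ≤ f' x) (n : ℕ) :
    unnormFilter ν χ q g n f ≤ unnormFilter ν χ q g n f' :=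
  integral_mono (((hg 0).mul (bddMeas_propagate hq hg hf 0 n)).integrable χ)
    (((hg 0).mul (bddMeas_propagate hq hg hf' 0 n)).integrable χ)
    fun x => mul_le_mul_of_nonneg_left (propagate_mono hq hq0 hg hg0 hf hf' hle 0 n x) (hg0 0 x)

lemma unnormFilter_const_mul {ν χ : Measure X} {q : X → X → ℝ} {g : ℕ → X → ℝ} {f : X → ℝ}
    (c : ℝ) (n : ℕ) :
    unnormFilter ν χ q g n (fun x => c * f x) = c * unnormFilter ν χ q g n f := by
  rw [unnormFilter, unnormFilter, ← integral_const_mul, propagate_const_mul]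
  congr 1; ext x; ring

lemma philt_eq_div {ν χ : Measure X} [IsFiniteMeasure ν] {q : X → X → ℝ} {g : ℕ → X → ℝ}
    {f : X → ℝ} (hq : BddMeas fun pr : X × X => q pr.1 pr.2) (hg : ∀ t, BddMeas (g t))
    (hf : BddMeas f) (n : ℕ) :
    philt ν χ q g n f = unnormFilter ν χ q g n f / unnormFilter ν χ q g n (fun _ => 1) := by
  have hL : ∀ f : X → ℝ, BddMeas f → ∀ x, Lop ν q g 0 n x f = propagate ν q g 0 n f x :=
    fun f hf x => by simpa using Lop_eq_propagate (ν := ν) hq hg hf 0 n x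
  simp only [philt, unnormFilter, hL f hf, hL _ (.const 1)]

end FeynmanKac

open FeynmanKac

theorem stmt_12 {X : Type*} [MeasurableSpace X] (ν : Measure X) (hν : ν Set.univ = 1)
    (σm σp cm : ℝ) (hσm : 0 < σm) (hσmp : σm ≤ σp) (hcm : 0 < cm)
    (q : X → X → ℝ) (hqmeas : Measurable fun pr : X × X => q pr.1 pr.2)
    (hq : ∀ x y, σm ≤ q x y ∧ q x y ≤ σp)
    (χ : Measure X) [IsProbabilityMeasure χ]
    (g : ℕ → X → ℝ) (hgmeas : ∀ t, Measurable (g t))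
    (hg0 : ∀ t x, 0 ≤ g t x) (hgb : ∃ K, ∀ t x, g t x ≤ K)
    (hχg0 : cm ≤ ∫ x, g 0 x ∂χ)
    (hqg : ∀ t, 1 ≤ t → ∀ x, cm ≤ ∫ y, q x y * g t y ∂ν)
    (ϑ : ℕ → X → ℝ) (hϑmeas : ∀ t, Measurable (ϑ t))
    (hϑpos : ∀ t, 1 ≤ t → ∀ x, 0 < ϑ t x)
    (hϑb : ∃ K, ∀ t, 1 ≤ t → ∀ x, ϑ t x ≤ K)
    (p : ℕ → X → X → ℝ) (hpmeas : ∀ t, Measurable fun pr : X × X => p t pr.1 pr.2)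
    (hppos : ∀ t, 1 ≤ t → ∀ x y, 0 < p t x y)
    (hpint : ∀ t, 1 ≤ t → ∀ x, ∫ y, p t x y ∂ν = 1)
    (hωb : ∃ K, ∀ t, 1 ≤ t → ∀ x y, omegaFn q g ϑ p t x y ≤ K)
    (r s : ℕ) (hr : 1 ≤ r) (hrs : r ≤ s)
    (h : X → ℝ) (hhm : Measurable h) (hhb : ∃ K, ∀ x, |h x| ≤ K)
    (hzero : philt ν χ q g s h = 0) :
    Vr ν χ q g ϑ p r s h ≤
      (⨆ x, |ϑ r x|) * (⨆ pr : X × X, |omegaFn q g ϑ p r pr.1 pr.2|) *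
        (σp / (cm * σm)) * (1 - σm / σp) ^ (2 * (s - r)) * osc h ^ 2 := by
  have : IsProbabilityMeasure ν := ⟨hν⟩
  have : Nonempty X := χ.nonempty_of_neZero
  have hσp := hσm.trans_le hσmp
  have hq0 : ∀ x y, 0 ≤ q x y := fun x y => hσm.le.trans (hq x y).1
  have hqB : BddMeas fun pr : X × X => q pr.1 pr.2 :=
    ⟨hqmeas, σp, fun pr => by rw [abs_of_nonneg (hq0 _ _)]; exact (hq _ _).2⟩
  have hgB : ∀ t, BddMeas (g t) := fun t =>
    ⟨hgmeas t, hgb.imp fun K hK x => by rw [abs_of_nonneg (hg0 _ _)]; exact hK t x⟩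
  have hϑB : BddMeas (ϑ r) :=
    ⟨hϑmeas r, hϑb.imp fun K hK x => by rw [abs_of_pos (hϑpos r hr x)]; exact hK r hr x⟩
  have hhB : BddMeas h := ⟨hhm, hhb⟩
  have hω0 : ∀ x y, 0 ≤ omegaFn q g ϑ p r x y := fun x y =>
    div_nonneg (mul_nonneg (hq0 x y) (hg0 r y)) (mul_pos (hϑpos r hr x) (hppos r hr x y)).le
  have hωB : BddMeas fun pr : X × X => omegaFn q g ϑ p r pr.1 pr.2 := by
    refine ⟨?_, hωb.imp fun K hK pr => by rw [abs_of_nonneg (hω0 _ _)]; exact hK r hr _ _⟩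
    exact (hqmeas.mul ((hgmeas r).comp measurable_snd)).div
      (((hϑmeas r).comp measurable_fst).mul (hpmeas r))
  set Θ := ⨆ x, |ϑ r x|
  set W := ⨆ pr : X × X, |omegaFn q g ϑ p r pr.1 pr.2|
  have hΘ : ∀ x, ϑ r x ≤ Θ := fun x => (le_abs_self _).trans
    (le_ciSup (f := fun x => |ϑ r x|)
      (hϑB.2.imp fun K hK => by rintro _ ⟨y, rfl⟩; exact hK y) x)
  have hW : ∀ x y, omegaFn q g ϑ p r x y ≤ W := fun x y => (le_abs_self _).trans
    (le_ciSup (f := fun pr : X × X => |omegaFn q g ϑ p r pr.1 pr.2|)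
      (hωB.2.imp fun K hK => by rintro _ ⟨y, rfl⟩; exact hK y) (x, y))
  have hΘ0 : 0 ≤ Θ := Real.iSup_nonneg fun _ => abs_nonneg _
  have hW0 : 0 ≤ W := Real.iSup_nonneg fun _ => abs_nonneg _
  obtain ⟨m, rfl⟩ : ∃ m, r = m + 1 := ⟨r - 1, by omega⟩
  obtain ⟨n, rfl⟩ : ∃ n, s = m + 1 + n := ⟨s - (m + 1), by omega⟩
  rw [show m + 1 + n - (m + 1) = n by omega]
  obtain ⟨a, b, hab, hosc, hhab⟩ := exists_bounds_sub_le_osc hhb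
  obtain ⟨a', b', hd, hle⟩ := exists_propagate_interval (ν := ν) hσm hσmp hcm hqB hq hgB hg0 hqg
    hhB hhab (m + 1) n
  obtain ⟨β, B, hβ, hβB, hL1⟩ := propagate_one_bounds (ν := ν) hσm hσmp hcm hqB hq hgB hg0 hqg
    (m + 1) n
  obtain ⟨δ, _, hδ, -, hδL⟩ := propagate_one_bounds (ν := ν) hσm hσmp hcm hqB hq hgB hg0 hqg
    0 m
  have hL1B := bddMeas_propagate (ν := ν) hqB hgB (.const 1) (m + 1) n
  have hLhB := bddMeas_propagate (ν := ν) hqB hgB hhB (m + 1) n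
  have hadd : ∀ f, unnormFilter ν χ q g (m + 1 + n) f =
      unnormFilter ν χ q g m (transOp ν q (g (m + 1)) (propagate ν q g (m + 1) n f)) := fun f => by
    rw [unnormFilter, unnormFilter, add_assoc, propagate_add, add_comm 1 n, propagate, zero_add]
  have hzero' := hzero
  rw [philt_eq_div hqB hgB hhB, hadd, hadd] at hzero'
  have hLop : ∀ y f, BddMeas f →
      Lop ν q g (m + 1) (m + 1 + n) y f = propagate ν q g (m + 1) n f y :=
    fun y f hf => Lop_eq_propagate hqB hgB hf (m + 1) n y
  have hnum : (fun x => ϑ (m + 1) x * ∫ y, p (m + 1) x y * omegaFn q g ϑ p (m + 1) x y ^ 2 *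
      Lop ν q g (m + 1) (m + 1 + n) y h ^ 2 ∂ν) = fun x => ∫ y, omegaFn q g ϑ p (m + 1) x y *
        (q x y * (g (m + 1) y * propagate ν q g (m + 1) n h y ^ 2)) ∂ν := by
    ext x
    rw [← integral_const_mul]
    congr 1; ext y
    have hϑx := (hϑpos _ hr x).ne'
    have hpx := (hppos _ hr x y).ne'
    rw [hLop y h hhB, omegaFn]
    field_simp
  rw [Vr, phipred, Nat.add_sub_cancel, hnum]
  simp only [hLop _ _ (BddMeas.const 1)]
  set L := propagate ν q g (m + 1) n (fun _ => 1)
  set H := propagate ν q g (m + 1) n h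
  have hH2 : BddMeas fun y => H y ^ 2 := by simpa only [sq] using hLhB.mul hLhB
  have hFB : BddMeas fun x => ∫ y, omegaFn q g ϑ p (m + 1) x y *
      (q x y * (g (m + 1) y * H y ^ 2)) ∂ν :=
    (hωB.mul (hqB.mul (((hgB (m + 1)).mul hH2).comp measurable_snd))).integral ν
  have hTL := bddMeas_transOp (ν := ν) hqB (hgB (m + 1)) hL1B
  have hT1 := bddMeas_transOp (ν := ν) hqB (hgB (m + 1)) (.const 1)
  change philt ν χ q g m _ * _ / philt ν χ q g m (transOp ν q (g (m + 1)) L) ^ 2 ≤ _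
  rw [philt_eq_div hqB hgB hFB, philt_eq_div hqB hgB hϑB, philt_eq_div hqB hgB hTL]
  have hmono : ∀ f f', BddMeas f → BddMeas f' → (∀ x, f x ≤ f' x) →
      unnormFilter ν χ q g m f ≤ unnormFilter ν χ q g m f' :=
    fun f f' hf hf' hff' => unnormFilter_mono hqB hq0 hgB hg0 hf hf' hff' m
  have hTmono : ∀ f f', BddMeas f → BddMeas f' → (∀ x, f x ≤ f' x) →
      ∀ x, transOp ν q (g (m + 1)) f x ≤ transOp ν q (g (m + 1)) f' x :=
    fun f f' hf hf' hff' => transOp_mono hqB hq0 (hgB _) (hg0 _) hf hf' hff'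
  set D := unnormFilter ν χ q g m (fun _ => 1) with hD
  set M := unnormFilter ν χ q g m (transOp ν q (g (m + 1)) L)
  have hDpos : 0 < D := by
    have hi := integral_mono (μ := χ) (((hgB 0).integrable χ).const_mul δ)
      (((hgB 0).mul (bddMeas_propagate (ν := ν) hqB hgB (.const 1) 0 m)).integrable χ)
      fun x => by
        simpa only [mul_comm δ] using mul_le_mul_of_nonneg_left (hδL x).1 (hg0 0 x)
    rw [integral_const_mul] at hi
    exact (mul_pos hδ (hcm.trans_le hχg0)).trans_le hi
  have hMlow : β * cm * D ≤ M := by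
    rw [hD, ← unnormFilter_const_mul]
    refine hmono _ _ ((BddMeas.const _).mul (.const 1)) hTL fun x => ?_
    have h1 := hTmono _ _ ((BddMeas.const β).mul (.const 1)) hL1B
      (fun y => by simpa using (hL1 y).1) x
    rw [transOp_const_mul] at h1
    refine le_trans ?_ h1
    rw [mul_one]
    refine mul_le_mul_of_nonneg_left ?_ hβ.le
    simpa only [transOp, mul_one] using hqg (m + 1) hr x
  have hMpos : 0 < M := lt_of_lt_of_le (by positivity) hMlow
  have hH0 : unnormFilter ν χ q g m (transOp ν q (g (m + 1)) H) = 0 :=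
    (div_eq_zero_iff.1 hzero').resolve_right hMpos.ne'
  have hcmul : ∀ c : ℝ, unnormFilter ν χ q g m (transOp ν q (g (m + 1)) fun x => c * L x) =
      c * M := fun c => by
    rw [show transOp ν q (g (m + 1)) (fun x => c * L x) =
      fun x => c * transOp ν q (g (m + 1)) L x from funext (transOp_const_mul c)]
    exact unnormFilter_const_mul c m
  have hcB : ∀ c : ℝ, BddMeas fun x => c * L x := fun c => (BddMeas.const c).mul hL1B
  have ha' : a' ≤ 0 := by
    have h1 := hmono _ _ (bddMeas_transOp (ν := ν) hqB (hgB (m + 1)) (hcB a'))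
      (bddMeas_transOp hqB (hgB _) hLhB) (hTmono _ _ (hcB a') hLhB fun x => (hle x).1)
    rw [hcmul, hH0] at h1
    exact nonpos_of_mul_nonpos_left h1 hMpos
  have hb' : 0 ≤ b' := by
    have h1 := hmono _ _ (bddMeas_transOp (ν := ν) hqB (hgB (m + 1)) hLhB)
      (bddMeas_transOp hqB (hgB _) (hcB b')) (hTmono _ _ hLhB (hcB b') fun x => (hle x).2)
    rw [hcmul, hH0] at h1
    exact nonneg_of_mul_nonneg_left h1 hMpos
  set c := b' - a' with hc
  have hc0 : 0 ≤ c := by linarith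
  have hLpos : ∀ x, 0 < L x := fun x => hβ.trans_le (hL1 x).1
  have hHsq : ∀ x, H x ^ 2 ≤ c ^ 2 * B * L x := fun x => by
    have habs : |H x| ≤ c * L x := abs_le.2
      ⟨by nlinarith [(hle x).1, hLpos x], by nlinarith [(hle x).2, hLpos x]⟩
    calc H x ^ 2 = |H x| ^ 2 := (sq_abs _).symm
      _ ≤ (c * L x) ^ 2 := by gcongr
      _ = c ^ 2 * L x * L x := by ring
      _ ≤ c ^ 2 * B * L x := by
        have := (hL1 x).2
        have := (hLpos x).le
        gcongr
  have hNF : unnormFilter ν χ q g m (fun x => ∫ y, omegaFn q g ϑ p (m + 1) x y *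
      (q x y * (g (m + 1) y * H y ^ 2)) ∂ν) ≤ W * (c ^ 2 * B) * M := by
    rw [← unnormFilter_const_mul]
    refine hmono _ _ hFB ((BddMeas.const _).mul hTL) fun x => ?_
    have hi := (bddMeas_section hqB x).mul ((hgB (m + 1)).mul hH2)
    calc _ ≤ ∫ y, W * (q x y * (g (m + 1) y * H y ^ 2)) ∂ν :=
          integral_mono (((bddMeas_section hωB x).mul hi).integrable ν)
            ((hi.integrable ν).const_mul W) fun y => mul_le_mul_of_nonneg_right (hW x y)
              (mul_nonneg (hq0 x y) (mul_nonneg (hg0 _ y) (sq_nonneg _)))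
      _ = W * transOp ν q (g (m + 1)) (fun y => H y ^ 2) x := integral_const_mul _ _
      _ ≤ W * transOp ν q (g (m + 1)) (fun y => c ^ 2 * B * L y) x :=
          mul_le_mul_of_nonneg_left (hTmono _ _ hH2 (hcB _) hHsq x) hW0
      _ = _ := by rw [transOp_const_mul]; ring
  have hNϑ : unnormFilter ν χ q g m (ϑ (m + 1)) ≤ Θ * D := by
    rw [hD, ← unnormFilter_const_mul]
    exact hmono _ _ hϑB ((BddMeas.const _).mul (.const 1)) fun x => by simpa using hΘ x
  have hNϑ0 : 0 ≤ unnormFilter ν χ q g m (ϑ (m + 1)) := by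
    have h1 := hmono _ _ ((BddMeas.const 0).mul (.const 1)) hϑB
      fun x => by simpa using (hϑpos _ hr x).le
    rwa [unnormFilter_const_mul, zero_mul] at h1
  have hB : 0 ≤ B := by
    obtain ⟨x⟩ := ‹Nonempty X›
    exact (hLpos x).le.trans (hL1 x).2
  have hρ : 0 ≤ 1 - σm / σp := sub_nonneg.2 ((div_le_one hσp).2 hσmp)
  have hcosc : c ≤ (1 - σm / σp) ^ n * osc h := by
    rw [hd]
    gcongr
  have hratio : B * D / M ≤ σp / (cm * σm) := by
    rw [div_le_div_iff₀ hMpos (by positivity)]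
    calc B * D * (cm * σm) = B * σm * (cm * D) := by ring
      _ ≤ σp * β * (cm * D) := by gcongr
      _ = σp * (β * cm * D) := by ring
      _ ≤ σp * M := by gcongr
  set N := unnormFilter ν χ q g m (fun x => ∫ y, omegaFn q g ϑ p (m + 1) x y *
      (q x y * (g (m + 1) y * H y ^ 2)) ∂ν)
  set E := unnormFilter ν χ q g m (ϑ (m + 1))
  calc N / D * (E / D) / (M / D) ^ 2 = N * E / M ^ 2 := by field_simp
    _ ≤ W * (c ^ 2 * B) * M * (Θ * D) / M ^ 2 := by gcongr
    _ = Θ * W * (B * D / M) * c ^ 2 := by field_simp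
    _ ≤ Θ * W * (σp / (cm * σm)) * ((1 - σm / σp) ^ n * osc h) ^ 2 := by gcongr
    _ = _ := by ring
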